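/- arXiv:2310.11365 — 6 statements merged into one kernel-verified Lean document; each statement's English description precedes it below -/
import Mathlib

section
/- Exactness of the Parareal iteration: Let X be an additive commutative group, let C, F : X → X be arbitrary maps, and let u₀ ∈ X. Define Parareal iterates u : ℕ → ℕ → X by u(k,0) = u₀ for all k, u(0,n+1) = C(u(0,n)), and u(k+1,n+1) = C(u(k+1,n)) + F(u(k,n)) − C(u(k,n)). Then for all k, n ∈ ℕ with n ≤ k, one has u(k,n) = F^[n](u₀), the n-fold iterate of F applied to u₀. -/
/-- Exactness of the Parareal iteration. -/
theorem parareal_exactness {X : Type*} [AddCommGroup X] (C F : X → X) (u₀ : X)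
    (u : ℕ → ℕ → X)
    (h_init : ∀ k, u k 0 = u₀)
    (h_coarse : ∀ n, u 0 (n + 1) = C (u 0 n))
    (h_iter : ∀ k n, u (k + 1) (n + 1) = C (u (k + 1) n) + F (u k n) - C (u k n)) :
    ∀ k n, n ≤ k → u k n = F^[n] u₀ := by
  intro k n
  induction n generalizing k with
  | zero => intro _; simpa using h_init k
  | succ n ih =>
    intro hk
    obtain ⟨k, rfl⟩ : ∃ j, k = j + 1 := ⟨k - 1, by omega⟩
    rw [h_iter, ih (k + 1) (by omega), ih k (by omega), Function.iterate_succ_apply',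
      add_sub_cancel_left]
end

section
/- Exactness of the micro-macro Parareal iteration: Let X and P be additive commutative groups, let F : X → X (fine propagator), C : P → P (coarse propagator), R : X → P (restriction), L : P → X (lifting), and Match : P → X → X (matching) be arbitrary maps satisfying Match(R(x), x) = x for all x ∈ X. Let u₀ ∈ X and define iterates ρ : ℕ → ℕ → P and u : ℕ → ℕ → X by ρ(k,0) = R(u₀) and u(k,0) = u₀ for all k; ρ(0,n+1) = C(ρ(0,n)) and u(0,n+1) = L(ρ(0,n+1)); and for k ≥ 0, ρ(k+1,n+1) = C(ρ(k+1,n)) + R(F(u(k,n))) − C(ρ(k,n)) and u(k+1,n+1) = Match(ρ(k+1,n+1), F(u(k,n))). Then for all k, n with n ≤ k, one has u(k,n) = F^[n](u₀) and ρ(k,n) = R(F^[n](u₀)). -/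
/-- Exactness of the micro-macro Parareal iteration. -/
theorem micro_macro_parareal_exactness {X P : Type*} [AddCommGroup X] [AddCommGroup P]
    (F : X → X) (C : P → P) (R : X → P) (L : P → X) (Match : P → X → X)
    (h_match : ∀ x : X, Match (R x) x = x)
    (u₀ : X) (ρ : ℕ → ℕ → P) (u : ℕ → ℕ → X)
    (hρ_init : ∀ k, ρ k 0 = R u₀)
    (hu_init : ∀ k, u k 0 = u₀)
    (hρ_coarse : ∀ n, ρ 0 (n + 1) = C (ρ 0 n))
    (hu_coarse : ∀ n, u 0 (n + 1) = L (ρ 0 (n + 1)))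
    (hρ_iter : ∀ k n, ρ (k + 1) (n + 1) = C (ρ (k + 1) n) + R (F (u k n)) - C (ρ k n))
    (hu_iter : ∀ k n, u (k + 1) (n + 1) = Match (ρ (k + 1) (n + 1)) (F (u k n))) :
    ∀ k n, n ≤ k → u k n = F^[n] u₀ ∧ ρ k n = R (F^[n] u₀) := by
  intro k n
  induction n generalizing k with
  | zero => intro _; exact ⟨hu_init k, hρ_init k⟩
  | succ n ih =>
    intro h
    obtain _ | k := k
    · omega
    · obtain ⟨h1, h2⟩ := ih k (by omega)
      obtain ⟨_, h4⟩ := ih (k + 1) (by omega)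
      have h5 : ρ (k + 1) (n + 1) = R (F^[n + 1] u₀) := by
        rw [hρ_iter, h4, h2, h1, Function.iterate_succ_apply', add_sub_cancel_left]
      refine ⟨?_, h5⟩
      rw [hu_iter, h5, h1, ← Function.iterate_succ_apply' F, h_match]
end

section
/- Superlinear convergence bound for Parareal on linear scalar problems: Let F, G ∈ ℝ with |G| < 1, let N ≥ 1, and let e : ℕ → ℕ → ℝ satisfy e(k,0) = 0 for all k and e(k+1,n+1) = G·e(k+1,n) + (F − G)·e(k,n) for all k, n. Then for every k ≥ 1, max_{1 ≤ n ≤ N} |e(k,n)| ≤ (|F − G|^k / k!)·(∏_{j=1}^{k} (N − j))·max_{1 ≤ n ≤ N} |e(0,n)|, i.e. max_{1 ≤ n ≤ N} |e(k,n)| ≤ |F − G|^k·C(N−1,k)·max_{1 ≤ n ≤ N} |e(0,n)| with C(N−1,k) the binomial coefficient. -/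
open Finset

lemma parareal_prod (m k : ℕ) :
    (∏ j ∈ Finset.Icc 1 k, (((m + 1 : ℕ) : ℝ) - (j : ℝ))) = (m.descFactorial k : ℝ) := by
  induction k with
  | zero => simp
  | succ k ih =>
    rw [Finset.prod_Icc_succ_top (by omega), ih, Nat.descFactorial_succ]
    rcases le_or_gt k m with h | h
    · push_cast [Nat.cast_sub h]
      ring
    · rw [Nat.descFactorial_of_lt h]
      simp

lemma parareal_pointwise (F G : ℝ) (hG : |G| < 1) (m : ℕ) (M : ℝ) (e : ℕ → ℕ → ℝ)
    (h_init : ∀ k, e k 0 = 0)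
    (h_rec : ∀ k n, e (k + 1) (n + 1) = G * e (k + 1) n + (F - G) * e k n)
    (hM : ∀ n ≤ m, |e 0 (n + 1)| ≤ M) (k : ℕ) :
    ∀ n ≤ m, |e k (n + 1)| ≤ |F - G| ^ k * (Nat.choose n k : ℝ) * M := by
  induction k with
  | zero => intro n hn; simpa using hM n hn
  | succ k ih =>
    intro n
    induction n with
    | zero => intro _; rw [h_rec]; simp [h_init]
    | succ n ihn =>
      intro hn
      have h1 := ihn (by omega)
      have h2 := ih n (by omega)
      have h3 : |G| * |e (k + 1) (n + 1)| ≤ |e (k + 1) (n + 1)| :=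
        mul_le_of_le_one_left (abs_nonneg _) hG.le
      have h4 := mul_le_mul_of_nonneg_left h2 (abs_nonneg (F - G))
      calc |e (k + 1) (n + 1 + 1)|
          ≤ |G| * |e (k + 1) (n + 1)| + |F - G| * |e k (n + 1)| := by
            rw [h_rec, ← abs_mul, ← abs_mul]; exact abs_add_le _ _
        _ ≤ |F - G| ^ (k + 1) * (Nat.choose n (k + 1) : ℝ) * M
            + |F - G| * (|F - G| ^ k * (Nat.choose n k : ℝ) * M) := by linarith
        _ = _ := by rw [Nat.choose_succ_succ]; push_cast; ring

/-- Superlinear convergence bound for Parareal on linear scalar problems. -/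
theorem parareal_superlinear_bound (F G : ℝ) (hG : |G| < 1) (N : ℕ) (hN : 1 ≤ N)
    (e : ℕ → ℕ → ℝ)
    (h_init : ∀ k, e k 0 = 0)
    (h_rec : ∀ k n, e (k + 1) (n + 1) = G * e (k + 1) n + (F - G) * e k n)
    (k : ℕ) (hk : 1 ≤ k) :
    (Finset.Icc 1 N).sup' (Finset.nonempty_Icc.mpr hN) (fun n => |e k n|) ≤
      (|F - G| ^ k / (Nat.factorial k : ℝ)) * (∏ j ∈ Finset.Icc 1 k, ((N : ℝ) - (j : ℝ))) *
        (Finset.Icc 1 N).sup' (Finset.nonempty_Icc.mpr hN) (fun n => |e 0 n|) ∧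
    (Finset.Icc 1 N).sup' (Finset.nonempty_Icc.mpr hN) (fun n => |e k n|) ≤
      |F - G| ^ k * (Nat.choose (N - 1) k : ℝ) *
        (Finset.Icc 1 N).sup' (Finset.nonempty_Icc.mpr hN) (fun n => |e 0 n|) := by
  have key : (Finset.Icc 1 N).sup' (Finset.nonempty_Icc.mpr hN) (fun n => |e k n|) ≤
      |F - G| ^ k * (Nat.choose (N - 1) k : ℝ) *
        (Finset.Icc 1 N).sup' (Finset.nonempty_Icc.mpr hN) (fun n => |e 0 n|) := by
    have hM : ∀ n ≤ N - 1, |e 0 (n + 1)| ≤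
        (Finset.Icc 1 N).sup' (Finset.nonempty_Icc.mpr hN) (fun n => |e 0 n|) := by
      intro n hn
      exact Finset.le_sup' (fun n => |e 0 n|) (Finset.mem_Icc.mpr ⟨by omega, by omega⟩)
    have hM0 := (abs_nonneg _).trans (hM 0 (by omega))
    apply Finset.sup'_le
    intro n hn
    rw [Finset.mem_Icc] at hn
    obtain ⟨n, rfl⟩ : ∃ i, n = i + 1 := ⟨n - 1, by omega⟩
    refine (parareal_pointwise F G hG (N - 1) _ e h_init h_rec hM k n (by omega)).trans ?_
    have hc : (Nat.choose n k : ℝ) ≤ (Nat.choose (N - 1) k : ℝ) := by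
      exact_mod_cast Nat.choose_le_choose k (by omega : n ≤ N - 1)
    gcongr
  refine ⟨?_, key⟩
  have hp := parareal_prod (N - 1) k
  rw [Nat.sub_add_cancel hN] at hp
  have hk0 : (Nat.factorial k : ℝ) ≠ 0 := by exact_mod_cast Nat.factorial_ne_zero k
  have hq : |F - G| ^ k / (Nat.factorial k : ℝ) * (∏ j ∈ Finset.Icc 1 k, ((N : ℝ) - (j : ℝ)))
      = |F - G| ^ k * (Nat.choose (N - 1) k : ℝ) := by
    rw [hp, Nat.descFactorial_eq_factorial_mul_choose]
    push_cast
    field_simp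
  rw [hq]
  exact key
end

section
/- Linear convergence bound for Parareal on linear scalar problems: Let F, G ∈ ℝ with |G| < 1, let N ≥ 1, and let e : ℕ → ℕ → ℝ satisfy e(k,0) = 0 for all k and e(k+1,n+1) = G·e(k+1,n) + (F − G)·e(k,n) for all k, n. Then for every k, max_{1 ≤ n ≤ N} |e(k,n)| ≤ (|F − G| / (1 − |G|))^k · max_{1 ≤ n ≤ N} |e(0,n)|. -/
open Finset

/-- Linear convergence bound for Parareal on linear scalar problems. -/
theorem parareal_linear_bound (F G : ℝ) (hG : |G| < 1) (N : ℕ) (hN : 1 ≤ N)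
    (e : ℕ → ℕ → ℝ)
    (h_init : ∀ k, e k 0 = 0)
    (h_rec : ∀ k n, e (k + 1) (n + 1) = G * e (k + 1) n + (F - G) * e k n)
    (k : ℕ) :
    (Finset.Icc 1 N).sup' (Finset.nonempty_Icc.mpr hN) (fun n => |e k n|) ≤
      (|F - G| / (1 - |G|)) ^ k *
        (Finset.Icc 1 N).sup' (Finset.nonempty_Icc.mpr hN) (fun n => |e 0 n|) := by
  set M := (Finset.Icc 1 N).sup' (Finset.nonempty_Icc.mpr hN) (fun n => |e 0 n|) with hM
  have hle : ∀ n, 1 ≤ n → n ≤ N → |e 0 n| ≤ M := fun n h1 h2 =>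
    Finset.le_sup' (fun n => |e 0 n|) (Finset.mem_Icc.mpr ⟨h1, h2⟩)
  have hM0 : 0 ≤ M := (abs_nonneg _).trans (hle 1 le_rfl hN)
  have hpos : 0 < 1 - |G| := by linarith
  set r := |F - G| / (1 - |G|) with hr
  have hr0 : 0 ≤ r := div_nonneg (abs_nonneg _) hpos.le
  have hFG : |F - G| = r * (1 - |G|) := by
    rw [hr, div_mul_cancel₀ _ hpos.ne']
  have key : ∀ k n, n ≤ N → |e k n| ≤ r ^ k * M := by
    intro k
    induction k with
    | zero =>
      intro n hn
      rcases Nat.eq_zero_or_pos n with rfl | h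
      · rw [h_init]; simpa using hM0
      · simpa using hle n h hn
    | succ k ih =>
      intro n
      induction n with
      | zero =>
        intro _
        rw [h_init, abs_zero]
        positivity
      | succ n ihn =>
        intro hn
        have h1 := ihn (by omega)
        have h2 := ih n (by omega)
        rw [h_rec]
        calc |G * e (k + 1) n + (F - G) * e k n|
            ≤ |G| * |e (k + 1) n| + |F - G| * |e k n| := by
              rw [← abs_mul, ← abs_mul]; exact abs_add_le _ _
          _ ≤ |G| * (r ^ (k + 1) * M) + |F - G| * (r ^ k * M) := by gcongr
          _ = r ^ (k + 1) * M := by rw [hFG]; ring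
  exact Finset.sup'_le _ _ fun n hn => key k n (Finset.mem_Icc.mp hn).2
end

section
/- Bound on the infinity norm of powers of M(β) for |β| < 1: Let N ≥ 1, β ∈ ℝ with |β| < 1, and let M(β) be the N×N real matrix with entries M(β)_{i,j} = β^{i−j−1} for i > j and 0 otherwise. Then for every k ≥ 1 and every row index i, Σ_{j} |(M(β)^k)_{i,j}| ≤ min( ((1 − |β|^{N−1})/(1 − |β|))^k , C(N−1, k) ), where C(N−1,k) is the binomial coefficient; consequently the maximum absolute row sum norm ‖M(β)^k‖_∞ is bounded by this minimum. -/
open Finset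

theorem toeplitz_aux_step (N : ℕ) (β : ℝ)
    (M : Matrix (Fin N) (Fin N) ℝ)
    (hM : ∀ i j : Fin N, M i j = if (j : ℕ) < (i : ℕ) then β ^ ((i : ℕ) - (j : ℕ) - 1) else 0)
    (k : ℕ) (f : ℕ → ℝ) (hf : ∀ l : Fin N, ∑ j, |(M ^ k) l j| ≤ f l) (i : Fin N) :
    ∑ j, |(M ^ (k + 1)) i j| ≤ ∑ l ∈ range (i : ℕ), |β| ^ ((i : ℕ) - 1 - l) * f l := by
  have h1 : ∑ j, |(M ^ (k + 1)) i j| ≤ ∑ l, |M i l| * f l := by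
    calc ∑ j, |(M ^ (k + 1)) i j| ≤ ∑ j, ∑ l, |M i l| * |(M ^ k) l j| := by
          refine Finset.sum_le_sum fun j _ => ?_
          rw [pow_succ', Matrix.mul_apply]
          refine (Finset.abs_sum_le_sum_abs _ _).trans (le_of_eq ?_)
          simp only [abs_mul]
      _ = ∑ l, |M i l| * ∑ j, |(M ^ k) l j| := by
          rw [Finset.sum_comm]
          simp only [Finset.mul_sum]
      _ ≤ _ := Finset.sum_le_sum fun l _ => mul_le_mul_of_nonneg_left (hf l) (abs_nonneg _)
  refine h1.trans (le_of_eq ?_)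
  have h2 : ∀ l : Fin N, |M i l| * f l =
      (fun l : ℕ => if l < (i : ℕ) then |β| ^ ((i : ℕ) - 1 - l) * f l else 0) l := by
    intro l
    simp only [hM]
    split_ifs
    · rw [abs_pow, Nat.sub_right_comm]
    · simp
  rw [Finset.sum_congr rfl fun l _ => h2 l,
    Fin.sum_univ_eq_sum_range (fun l : ℕ => if l < (i : ℕ) then |β| ^ ((i : ℕ) - 1 - l) * f l else 0) N,
    ← Finset.sum_filter]
  congr 1
  ext l
  have := i.2
  simp only [Finset.mem_filter, Finset.mem_range]
  omega

theorem toeplitz_aux_choose (k n : ℕ) :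
    ∑ l ∈ range n, (Nat.choose l k : ℝ) = (Nat.choose n (k + 1) : ℝ) := by
  induction n with
  | zero => simp
  | succ n ih =>
    rw [Finset.sum_range_succ, ih, Nat.choose_succ_succ]
    push_cast
    ring

/-- Bound on the infinity norm (row sums) of powers of `M(β)` for `|β| < 1`. -/
theorem toeplitz_power_row_sum_bound_lt_one (N : ℕ) (hN : 1 ≤ N) (β : ℝ) (hβ : |β| < 1)
    (M : Matrix (Fin N) (Fin N) ℝ)
    (hM : ∀ i j : Fin N, M i j = if (j : ℕ) < (i : ℕ) then β ^ ((i : ℕ) - (j : ℕ) - 1) else 0)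
    (k : ℕ) (hk : 1 ≤ k) (i : Fin N) :
    ∑ j, |(M ^ k) i j| ≤
      min (((1 - |β| ^ (N - 1)) / (1 - |β|)) ^ k) ((Nat.choose (N - 1) k : ℝ)) := by
  have h0 : ∀ i : Fin N, ∑ j, |(M ^ 0) i j| = 1 := by
    intro i
    rw [Finset.sum_eq_single i]
    · simp
    · intro j _ hj
      simp [Matrix.one_apply_ne hj.symm]
    · simp
  have hg : (1 - |β| ^ (N - 1)) / (1 - |β|) = ∑ l ∈ range (N - 1), |β| ^ l := by
    rw [geom_sum_eq hβ.ne, ← neg_div_neg_eq, neg_sub, neg_sub]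
  refine le_min ?_ ?_
  · rw [hg]
    clear hk
    set G := ∑ l ∈ range (N - 1), |β| ^ l with hG
    have hG0 : 0 ≤ G := Finset.sum_nonneg fun l _ => pow_nonneg (abs_nonneg _) _
    induction k generalizing i with
    | zero => rw [h0]; simp
    | succ k ih =>
      refine (toeplitz_aux_step N β M hM k (fun _ => G ^ k) ih i).trans ?_
      rw [← Finset.sum_mul, Finset.sum_range_reflect (fun l => |β| ^ l), pow_succ']
      refine mul_le_mul_of_nonneg_right ?_ (pow_nonneg hG0 _)
      refine Finset.sum_le_sum_of_subset_of_nonneg ?_ fun l _ _ => pow_nonneg (abs_nonneg _) _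
      have := i.2
      exact Finset.range_subset_range.2 (by omega)
  · have key : ∑ j, |(M ^ k) i j| ≤ (Nat.choose i k : ℝ) := by
      clear hk
      induction k generalizing i with
      | zero => rw [h0]; simp
      | succ k ih =>
        refine (toeplitz_aux_step N β M hM k (fun l => (Nat.choose l k : ℝ)) ih i).trans ?_
        rw [← toeplitz_aux_choose]
        refine Finset.sum_le_sum fun l _ => ?_
        exact mul_le_of_le_one_left (Nat.cast_nonneg _) (pow_le_one₀ (abs_nonneg _) hβ.le)
    refine key.trans ?_
    have := i.2
    exact_mod_cast Nat.choose_le_choose k (by omega)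
end

section
/- Bound on the infinity norm of powers of M(β) for |β| ≥ 1: Let N ≥ 1, β ∈ ℝ with |β| ≥ 1, let 1 ≤ k ≤ N−1, and let M(β) be the N×N real matrix with entries M(β)_{i,j} = β^{i−j−1} for i > j and 0 otherwise. Then for every row index i, Σ_{j} |(M(β)^k)_{i,j}| ≤ |β|^{N−k−1}·C(N−1, k), where C(N−1,k) is the binomial coefficient; consequently ‖M(β)^k‖_∞ ≤ |β|^{N−k−1}·C(N−1,k). -/
open Finset

lemma hockey_aux (k n : ℕ) : ∑ l ∈ Finset.range n, (Nat.choose l k : ℝ) = (Nat.choose n (k+1) : ℝ) := by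
  induction n with
  | zero => simp
  | succ n ih =>
    rw [Finset.sum_range_succ, ih, Nat.choose_succ_succ]
    push_cast
    ring

lemma row_aux (N : ℕ) (β : ℝ) (hβ : 1 ≤ |β|)
    (M : Matrix (Fin N) (Fin N) ℝ)
    (hM : ∀ i j : Fin N, M i j = if (j : ℕ) < (i : ℕ) then β ^ ((i : ℕ) - (j : ℕ) - 1) else 0)
    (k : ℕ) : ∀ i : Fin N,
    ∑ j, |(M ^ k) i j| ≤ |β| ^ ((i : ℕ) - k) * (Nat.choose i k : ℝ) := by
  induction k with
  | zero =>
    intro i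
    have h : ∑ j, |(M ^ 0) i j| = 1 := by
      rw [pow_zero, Finset.sum_eq_single i]
      · simp
      · intro b _ hb
        simp [Matrix.one_apply_ne (Ne.symm hb)]
      · simp
    rw [h]
    simpa using one_le_pow₀ hβ
  | succ k ih =>
    intro i
    calc ∑ j, |(M ^ (k+1)) i j| ≤ ∑ j, ∑ l, |M i l| * |(M ^ k) l j| := by
          refine Finset.sum_le_sum fun j _ => ?_
          rw [pow_succ', Matrix.mul_apply]
          refine (Finset.abs_sum_le_sum_abs _ _).trans (le_of_eq ?_)
          simp [abs_mul]
      _ = ∑ l, |M i l| * ∑ j, |(M ^ k) l j| := by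
          rw [Finset.sum_comm]
          simp [Finset.mul_sum]
      _ ≤ ∑ l : Fin N, (if (l : ℕ) < (i : ℕ) then
            |β| ^ ((i : ℕ) - (k + 1)) * (Nat.choose l k : ℝ) else 0) := by
          refine Finset.sum_le_sum fun l _ => ?_
          rw [hM]
          split_ifs with h
          · rw [abs_pow]
            refine (mul_le_mul_of_nonneg_left (ih l) (by positivity)).trans ?_
            rcases lt_or_ge (l : ℕ) k with h' | h'
            · simp [Nat.choose_eq_zero_of_lt h']
            · rw [← mul_assoc, ← pow_add]
              have : (i : ℕ) - l - 1 + (l - k) = i - (k + 1) := by omega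
              rw [this]
          · simp
      _ = ∑ l ∈ Finset.range N, (if l < (i : ℕ) then
            |β| ^ ((i : ℕ) - (k + 1)) * (Nat.choose l k : ℝ) else 0) :=
          Fin.sum_univ_eq_sum_range (fun l => if l < (i : ℕ) then
            |β| ^ ((i : ℕ) - (k + 1)) * (Nat.choose l k : ℝ) else 0) N
      _ = |β| ^ ((i : ℕ) - (k + 1)) * (Nat.choose i (k + 1) : ℝ) := by
          rw [← Finset.sum_filter, ← hockey_aux, Finset.mul_sum]
          refine Finset.sum_congr ?_ fun _ _ => rfl
          ext l
          have := i.2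
          simp only [Finset.mem_filter, Finset.mem_range]
          omega

/-- Bound on the infinity norm (row sums) of powers of `M(β)` for `|β| ≥ 1`. -/
theorem toeplitz_power_row_sum_bound_ge_one (N : ℕ) (hN : 1 ≤ N) (β : ℝ) (hβ : 1 ≤ |β|)
    (M : Matrix (Fin N) (Fin N) ℝ)
    (hM : ∀ i j : Fin N, M i j = if (j : ℕ) < (i : ℕ) then β ^ ((i : ℕ) - (j : ℕ) - 1) else 0)
    (k : ℕ) (hk1 : 1 ≤ k) (hk2 : k ≤ N - 1) (i : Fin N) :
    ∑ j, |(M ^ k) i j| ≤ |β| ^ (N - k - 1) * (Nat.choose (N - 1) k : ℝ) := by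
  have hi := i.2
  refine (row_aux N β hβ M hM k i).trans ?_
  refine mul_le_mul (pow_le_pow_right₀ hβ (by omega)) ?_ (by positivity) (by positivity)
  exact_mod_cast Nat.choose_le_choose k (by omega)
end
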